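/- arXiv:2108.12593 — 3 statements merged into one kernel-verified Lean document; each statement's English description precedes it below -/
import Mathlib

section
/- There exists a weighing matrix W(43, 25), that is, a 43 × 43 integer matrix W with entries in {-1, 0, 1} satisfying W * Wᵀ = 25 • (identity matrix of order 43). -/
open Matrix

/-- The rows of a weighing matrix `W(43, 25)`: the `j`-th ternary digit of an entry, minus one,
is the `j`-th coordinate of the row. -/
def weighingRowCodes : List ℕ :=
  [ 164128515362470788794, 164128549675955990264, 199600849170755743796, 128680933405155618662,
    199625727682510735540, 128681128692986681956, 199625796318098321410, 164103570872028478484,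
    274357860325765788656, 274327800218791943290, 274337271209985836612, 274365684188594801682,
    53905695585850981196, 170182346699461067180, 170182315996982613502, 170182310779048965258,
    170182231114526949438, 170182298681217921422, 174685144044749489462, 174685210635752581336,
    174685049049060435882, 174685132361648399492, 174685162474576478778, 2086233612191032450,
    2056076211233637822, 293950502171500892104, 2065703571847435474, 293971150356959317606,
    293980464981119245748, 2093953567521856874, 293957024234635729866, 293942574401648707066,
    2079578645248476580, 82617163579849433396, 82647187798939024146, 227628346824797973736,
    82637883606565719442, 227607888627048909804, 227598250835008064354, 82609466983835946682,
    227621787896770439242, 227636297955870447844, 82623781685799956884 ]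

/-- The integer matrix encoded by `weighingRowCodes`. -/
def weighingMatrix43 : Matrix (Fin 43) (Fin 43) ℤ :=
  fun i j => ((weighingRowCodes.getD i 0 / 3 ^ (j : ℕ) % 3 : ℕ) : ℤ) - 1

theorem weighingMatrix43_entry (i j : Fin 43) :
    weighingMatrix43 i j = -1 ∨ weighingMatrix43 i j = 0 ∨ weighingMatrix43 i j = 1 := by
  unfold weighingMatrix43
  omega

theorem weighingMatrix43_dot (i k : Fin 43) :
    ∑ j, weighingMatrix43 i j * weighingMatrix43 k j = if i = k then 25 else 0 := by
  revert i k
  decide +kernel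

/-- There exists a weighing matrix `W(43, 25)`. -/
theorem stmt_4 :
    ∃ W : Matrix (Fin 43) (Fin 43) ℤ,
      (∀ i j, W i j = -1 ∨ W i j = 0 ∨ W i j = 1) ∧
      W * Wᵀ = (25 : ℤ) • 1 := by
  refine ⟨weighingMatrix43, weighingMatrix43_entry, ?_⟩
  ext i k
  simp [Matrix.mul_apply, weighingMatrix43_dot, Matrix.one_apply]
end

section
/- Let p be an odd prime power (p = q^t with q an odd prime, t ≥ 1) and let m be a positive integer, and let M be the natural number with (p - 1) * M = p^m - 1. Suppose there exist a p × 2p matrix D and a (p+1) × 2p matrix R, both with entries in {0, 1}, such that the (2p+1) × (2p+1) matrix N obtained by prepending to the vertical block matrix [D; R] a first column whose first p entries are 1 and whose last p+1 entries are 0 satisfies N * Nᵀ = ((p+1)/2) • I + ((p-1)/2) • J (so N is the incidence matrix of a symmetric 2-(2p+1, p, (p-1)/2) design), and such that the complement J - R of the residual part satisfies (J - R) * (J - R)ᵀ = ((p+1)/2) • I + ((p-1)/2) • J with every column of J - R summing to (p+1)/2 (the residual design has a twin mate). Then there exists a (0,1)-matrix N' of order 2p*M + 1 such that N' * N'ᵀ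 = (p^(m-1) * (p+1) / 2) • I + (p^(m-1) * (p-1) / 2) • J and every row of N' sums to p^m; that is, N' is the incidence matrix of a symmetric 2-(2pM + 1, p^m, p^(m-1)(p-1)/2) design. -/
open Matrix

/-- The incidence matrix of the symmetric `2-(2p+1, p, (p-1)/2)` design obtained by
prepending to the vertical block matrix `[D; R]` a column whose first `p` entries are `1`
and whose last `p+1` entries are `0`. -/
def designN (p : ℕ) (D : Matrix (Fin p) (Fin (2 * p)) ℤ)
    (R : Matrix (Fin (p + 1)) (Fin (2 * p)) ℤ) :
    Matrix (Fin p ⊕ Fin (p + 1)) (Unit ⊕ Fin (2 * p)) ℤ :=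
  Matrix.of fun r c =>
    match r, c with
    | Sum.inl _, Sum.inl _ => 1
    | Sum.inr _, Sum.inl _ => 0
    | Sum.inl i, Sum.inr j => D i j
    | Sum.inr i, Sum.inr j => R i j

open scoped LinearAlgebra.Projectivization

/-- The values of a surjective additive map between finite groups are equidistributed. -/
lemma card_mul_sum_comp_of_surjective {V U : Type*} [AddCommGroup V] [Fintype V]
    [AddCommGroup U] [Fintype U] (L : V →+ U) (hL : Function.Surjective L) (g : U → ℤ) :
    (Fintype.card U : ℤ) * ∑ v, g (L v) = Fintype.card V * ∑ u, g u := by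
  have translate (u : U) : ∑ v, g (L v) = ∑ v, g (L v + u) := by
    obtain ⟨w, rfl⟩ := hL u
    simpa using (Equiv.sum_comp (Equiv.addRight w) fun v => g (L v)).symm
  calc
    (Fintype.card U : ℤ) * ∑ v, g (L v) = ∑ u, ∑ v, g (L v + u) := by
      rw [← Finset.sum_congr rfl fun u _ => translate u]
      simp
    _ = ∑ v, ∑ u, g (L v + u) := Finset.sum_comm
    _ = Fintype.card V * ∑ u, g u := by
      simp [Equiv.sum_comp (Equiv.addLeft _) g, ← Equiv.coe_addLeft]

/-- Every nonzero vector is a unique unit multiple of the representative of its point. -/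
lemma bijective_units_smul_rep (F V : Type*) [Field F] [AddCommGroup V] [Module F V] :
    Function.Bijective fun x : ℙ F V × Fˣ =>
      (⟨x.2 • x.1.rep, (smul_ne_zero_iff_ne _).2 x.1.rep_nonzero⟩ : {v : V // v ≠ 0}) := by
  constructor
  · rintro ⟨P, a⟩ ⟨Q, b⟩ h
    have h : a • P.rep = b • Q.rep := congrArg Subtype.val h
    obtain rfl : P = Q := by
      rw [← P.mk_rep, ← Q.mk_rep, Projectivization.mk_eq_mk_iff]
      exact ⟨a⁻¹ * b, by rw [mul_smul, ← h, inv_smul_smul]⟩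
    have : (a : F) = b := smul_left_injective F P.rep_nonzero h
    simp [Units.ext this]
  · rintro ⟨v, hv⟩
    obtain ⟨a, ha⟩ := Projectivization.exists_smul_eq_mk_rep F v hv
    exact ⟨(.mk F v hv, a⁻¹), Subtype.ext (by simp [← ha])⟩

/-- A sum of a homogeneous function over a finite space, computed on projective points. -/
lemma sum_eq_card_sub_one_mul_sum_rep {F V : Type*} [Field F] [Fintype F] [AddCommGroup V]
    [Module F V] [Fintype V] [Fintype (ℙ F V)] (f : V → ℤ) (h0 : f 0 = 0)
    (hf : ∀ (a : Fˣ) v, f (a • v) = f v) :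
    ∑ v, f v = ((Fintype.card F : ℤ) - 1) * ∑ P : ℙ F V, f P.rep := by
  classical
  have hsub : ∑ v : {v : V // v ≠ 0}, f v = ∑ v, f v := by
    rw [← Finset.sum_filter_of_ne (p := fun v : V => v ≠ 0) fun v _ hv hv0 => hv (hv0 ▸ h0)]
    exact (Finset.sum_subtype _ (by simp) f).symm
  rw [← hsub, ← (bijective_units_smul_rep F V).sum_comp fun v => f v, Fintype.sum_prod_type]
  simp [hf, Fintype.card_units, ← Finset.mul_sum, Nat.cast_sub Fintype.card_pos]

lemma surjective_dotProduct_pair {F : Type*} [Field F] {m : ℕ}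
    {P Q : ℙ F (Fin m → F)} (h : P ≠ Q) :
    Function.Surjective
      ((dotProductBilin F F P.rep).prod (dotProductBilin F F Q.rep)) := by
  have hli := Projectivization.independent_iff.1
    ((Projectivization.independent_pair_iff_ne P Q).2 h)
  let A : Matrix (Fin 2) (Fin m) F := Matrix.of (Projectivization.rep ∘ ![P, Q])
  have hrank : A.rank = 2 := by simpa using LinearIndependent.rank_matrix (M := A) hli
  have hA : Function.Surjective A.mulVecLin := by
    rw [← LinearMap.range_eq_top]
    exact Submodule.eq_top_of_finrank_eq (by simpa [Matrix.rank] using hrank)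
  rintro ⟨x, y⟩
  obtain ⟨v, hv⟩ := hA ![x, y]
  exact ⟨v, Prod.ext (congrFun hv 0) (congrFun hv 1)⟩

/-- Two coordinates given by distinct points are jointly equidistributed. -/
lemma card_sq_mul_sum_dotProduct_pair {F : Type*} [Field F] [Fintype F] {m : ℕ}
    [Fintype (ℙ F (Fin m → F))] {P Q : ℙ F (Fin m → F)} (h : P ≠ Q) (f : F → ℤ)
    (h0 : f 0 = 0) (hf : ∀ (a : Fˣ) s t, f (a * s) * f (a * t) = f s * f t) :
    (Fintype.card F : ℤ) ^ 2 * (((Fintype.card F : ℤ) - 1) *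
      ∑ X : ℙ F (Fin m → F), f (P.rep ⬝ᵥ X.rep) * f (Q.rep ⬝ᵥ X.rep)) =
      Fintype.card F ^ m * (∑ s, f s) ^ 2 := by
  have key := card_mul_sum_comp_of_surjective
    ((dotProductBilin F F P.rep).prod (dotProductBilin F F Q.rep)).toAddMonoidHom
    (surjective_dotProduct_pair h) fun s => f s.1 * f s.2
  have hsum := sum_eq_card_sub_one_mul_sum_rep (F := F)
    (fun v : Fin m → F => f (P.rep ⬝ᵥ v) * f (Q.rep ⬝ᵥ v)) (by simp [h0])
    (fun u v => by simp [Units.smul_def, hf])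
  simp only [LinearMap.toAddMonoidHom_coe, LinearMap.prod_apply, Function.prod,
    dotProductBilin_apply_apply, hsum, Fintype.card_prod, Fintype.sum_prod_type,
    Fintype.card_fun, Fintype.card_fin, Nat.cast_pow, Nat.cast_mul, ← Finset.mul_sum,
    ← Finset.sum_mul] at key
  rw [sq, key, sq]

lemma card_sub_one_mul_card_projectivization {F : Type*} [Field F] [Fintype F] {m : ℕ}
    [Fintype (ℙ F (Fin m → F))] :
    ((Fintype.card F : ℤ) - 1) * Fintype.card (ℙ F (Fin m → F)) = Fintype.card F ^ m - 1 := by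
  have h := Projectivization.card' F (Fin m → F)
  simp only [Nat.card_eq_fintype_card, Fintype.card_fun, Fintype.card_fin] at h
  zify [Fintype.card_pos (α := F)] at h
  linear_combination -h

section QuadraticCharacter

variable {F : Type*} [Field F] [Fintype F] [DecidableEq F]

lemma sum_quadraticChar_sq : ∑ a : F, quadraticChar F a ^ 2 = (Fintype.card F : ℤ) - 1 := by
  have h (a : F) : quadraticChar F a ^ 2 = 1 - if a = 0 then 1 else 0 := by
    split_ifs with ha
    · simp [ha]
    · rw [quadraticChar_sq_one ha, sub_zero]
  simp only [h, Finset.sum_sub_distrib]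
  simp

lemma quadraticChar_units_sq (a : Fˣ) : quadraticChar F a ^ 2 = 1 :=
  quadraticChar_sq_one a.ne_zero

variable {m : ℕ} [Fintype (ℙ F (Fin m → F))]

lemma card_mul_sum_quadraticChar_sq {a : Fin m → F} (ha : a ≠ 0) :
    (Fintype.card F : ℤ) * ∑ P : ℙ F (Fin m → F), quadraticChar F (a ⬝ᵥ P.rep) ^ 2 =
      Fintype.card F ^ m := by
  have hL : Function.Surjective (dotProductBilin F F a) := LinearMap.surjective fun h =>
    ha (dotProduct_eq_zero a fun w => LinearMap.congr_fun h w)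
  have key := card_mul_sum_comp_of_surjective (dotProductBilin F F a).toAddMonoidHom hL
    fun s => quadraticChar F s ^ 2
  have hsum := sum_eq_card_sub_one_mul_sum_rep (F := F)
    (fun v : Fin m → F => quadraticChar F (a ⬝ᵥ v) ^ 2) (by simp)
    (fun u v => by
      simp [Units.smul_def, mul_pow, quadraticChar_units_sq, -quadraticChar_apply])
  simp only [LinearMap.toAddMonoidHom_coe, dotProductBilin_apply_apply, hsum,
    sum_quadraticChar_sq, Fintype.card_fun, Fintype.card_fin, Nat.cast_pow] at key
  have : (Fintype.card F : ℤ) - 1 ≠ 0 := by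
    have := Fintype.one_lt_card (α := F)
    lia
  apply mul_left_cancel₀ this
  linear_combination key

lemma sum_quadraticChar_mul_eq_zero (hF : ringChar F ≠ 2) {P Q : ℙ F (Fin m → F)} (h : P ≠ Q) :
    ∑ X : ℙ F (Fin m → F), quadraticChar F (P.rep ⬝ᵥ X.rep) * quadraticChar F (Q.rep ⬝ᵥ X.rep)
      = 0 := by
  have key := card_sq_mul_sum_dotProduct_pair h (quadraticChar F) (by simp) fun a s t => by
    rw [map_mul, map_mul]
    linear_combination quadraticChar F s * quadraticChar F t * quadraticChar_units_sq a
  have := Fintype.one_lt_card (α := F)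
  have h1 : (Fintype.card F : ℤ) ≠ 0 := by lia
  have h2 : (Fintype.card F : ℤ) - 1 ≠ 0 := by lia
  simpa [quadraticChar_sum_zero hF, h1, h2, -quadraticChar_apply] using key

lemma card_sq_mul_sum_quadraticChar_sq_mul {P Q : ℙ F (Fin m → F)} (h : P ≠ Q) :
    (Fintype.card F : ℤ) ^ 2 * ∑ X : ℙ F (Fin m → F),
      quadraticChar F (P.rep ⬝ᵥ X.rep) ^ 2 * quadraticChar F (Q.rep ⬝ᵥ X.rep) ^ 2 =
      Fintype.card F ^ m * ((Fintype.card F : ℤ) - 1) := by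
  have key := card_sq_mul_sum_dotProduct_pair h (fun s => quadraticChar F s ^ 2) (by simp)
    fun a s t => by simp [mul_pow, quadraticChar_units_sq, -quadraticChar_apply]
  have := Fintype.one_lt_card (α := F)
  have h2 : (Fintype.card F : ℤ) - 1 ≠ 0 := by lia
  rw [sum_quadraticChar_sq] at key
  apply mul_left_cancel₀ h2
  linear_combination key

end QuadraticCharacter

section Construction

variable {F : Type*} [Field F] [Fintype F] [DecidableEq F] {ρ κ : Type*}

/-- The block `R`, its complement `1 - R` or the zero block, according to the sign `s`. -/
def signedBlock (R : Matrix ρ κ ℤ) (s : ℤ) : Matrix ρ κ ℤ :=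
  Matrix.of fun r c => if s = 0 then 0 else if s = 1 then R r c else 1 - R r c

lemma signedBlock_eq_zero_or_one {R : Matrix ρ κ ℤ} (hR : ∀ r c, R r c = 0 ∨ R r c = 1)
    (s : ℤ) (r : ρ) (c : κ) : signedBlock R s r c = 0 ∨ signedBlock R s r c = 1 := by
  have := hR r c
  simp only [signedBlock, of_apply]
  split_ifs <;> lia

lemma two_mul_signedBlock_quadraticChar (R : Matrix ρ κ ℤ) (a : F) (r : ρ) (c : κ) :
    2 * signedBlock R (quadraticChar F a) r c =
      quadraticChar F a ^ 2 + quadraticChar F a * (2 * R r c - 1) := by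
  by_cases ha : a = 0
  · simp [signedBlock, ha]
  · rcases quadraticChar_dichotomy ha with h | h
    · simp only [signedBlock, of_apply, h]
      norm_num
    · simp only [signedBlock, of_apply, h]
      norm_num
      ring

/-- The matrix assembled from a derived block `D` with rows indexed by `F` and a residual block
`R`: its upper rows are the vectors of `F ^ m`, encoded through `D` by their dot products with the
projective points, and its lower rows replace the entries of the weighing matrix
`quadraticChar F (P ⬝ᵥ Q)` by `R`, `1 - R` or `0`. -/
noncomputable def designMatrix (m : ℕ) (D : Matrix F κ ℤ) (R : Matrix ρ κ ℤ) :
    Matrix ((Fin m → F) ⊕ (ℙ F (Fin m → F) × ρ)) (Unit ⊕ (ℙ F (Fin m → F) × κ)) ℤ :=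
  Matrix.fromBlocks (Matrix.of fun _ _ => 1) (Matrix.of fun x j => D (x ⬝ᵥ j.1.rep) j.2)
    0 (Matrix.of fun i j => signedBlock R (quadraticChar F (i.1.rep ⬝ᵥ j.1.rep)) i.2 j.2)

lemma designMatrix_eq_zero_or_one (m : ℕ) {D : Matrix F κ ℤ} {R : Matrix ρ κ ℤ}
    (hD : ∀ a c, D a c = 0 ∨ D a c = 1) (hR : ∀ r c, R r c = 0 ∨ R r c = 1) (i j) :
    designMatrix m D R i j = 0 ∨ designMatrix m D R i j = 1 := by
  rcases i with x | i <;> rcases j with _ | j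
  · exact .inr rfl
  · exact hD _ _
  · exact .inl rfl
  · exact signedBlock_eq_zero_or_one hR _ _ _

variable [Fintype κ] {m : ℕ} [Fintype (ℙ F (Fin m → F))]

lemma sum_mul_derived {D : Matrix F κ ℤ}
    (hDD : ∀ a b, 2 * ∑ c, D a c * D b c =
      (if a = b then (Fintype.card F : ℤ) + 1 else 0) + (Fintype.card F - 3))
    (x y : Fin m → F) :
    2 * Fintype.card F *
      (1 + ∑ j : ℙ F (Fin m → F) × κ, D (x ⬝ᵥ j.1.rep) j.2 * D (y ⬝ᵥ j.1.rep) j.2) =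
      Fintype.card F ^ m *
        ((if x = y then (Fintype.card F : ℤ) + 1 else 0) + (Fintype.card F - 1)) := by
  have hchar (a b : F) : 2 * ∑ c, D a c * D b c =
      2 * ((Fintype.card F : ℤ) - 1) - (Fintype.card F + 1) * quadraticChar F (a - b) ^ 2 := by
    rw [hDD]
    split_ifs with h
    · simp [h]; ring
    · rw [quadraticChar_sq_one (sub_ne_zero.2 h)]; ring
  have hsum : 2 * ∑ j : ℙ F (Fin m → F) × κ, D (x ⬝ᵥ j.1.rep) j.2 * D (y ⬝ᵥ j.1.rep) j.2 =
      2 * (((Fintype.card F : ℤ) - 1) * Fintype.card (ℙ F (Fin m → F))) -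
        (Fintype.card F + 1) * ∑ P : ℙ F (Fin m → F), quadraticChar F ((x - y) ⬝ᵥ P.rep) ^ 2 := by
    rw [Fintype.sum_prod_type, Finset.mul_sum]
    simp only [hchar, Finset.sum_sub_distrib, ← Finset.mul_sum, ← sub_dotProduct]
    simp only [Finset.sum_const, Finset.card_univ, nsmul_eq_mul]
    ring
  rw [card_sub_one_mul_card_projectivization] at hsum
  split_ifs with h
  · simp only [h, sub_self, zero_dotProduct, quadraticChar_zero] at hsum ⊢
    simp only [ne_eq, OfNat.ofNat_ne_zero, not_false_eq_true, zero_pow, Finset.sum_const_zero]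
      at hsum
    linear_combination (Fintype.card F : ℤ) * hsum
  · linear_combination (Fintype.card F : ℤ) * hsum -
      ((Fintype.card F : ℤ) + 1) * card_mul_sum_quadraticChar_sq (sub_ne_zero.2 h)

lemma sum_derived_mul_residual {D : Matrix F κ ℤ} {R : Matrix ρ κ ℤ}
    (hD : ∀ a, ∑ c, D a c = (Fintype.card F : ℤ) - 1)
    (hDR : ∀ a r, 2 * ∑ c, D a c * R r c = (Fintype.card F : ℤ) - 1)
    (x : Fin m → F) (P : ℙ F (Fin m → F)) (r : ρ) :
    2 * Fintype.card F * ∑ j : ℙ F (Fin m → F) × κ,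
      D (x ⬝ᵥ j.1.rep) j.2 * signedBlock R (quadraticChar F (P.rep ⬝ᵥ j.1.rep)) r j.2 =
      Fintype.card F ^ m * ((Fintype.card F : ℤ) - 1) := by
  have hblock (a b : F) : 2 * ∑ c, D a c * signedBlock R (quadraticChar F b) r c =
      ((Fintype.card F : ℤ) - 1) * quadraticChar F b ^ 2 := by
    set s := quadraticChar F b with hs
    calc
      _ = ∑ c, ((s ^ 2 - s) * D a c + 2 * s * (D a c * R r c)) := by
        rw [Finset.mul_sum]
        refine Finset.sum_congr rfl fun c _ => ?_
        linear_combination D a c * two_mul_signedBlock_quadraticChar R b r c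
      _ = _ := by
        rw [Finset.sum_add_distrib, ← Finset.mul_sum, ← Finset.mul_sum, hD]
        linear_combination s * hDR a r
  have key := card_mul_sum_quadraticChar_sq P.rep_nonzero
  rw [mul_comm 2, mul_assoc, Fintype.sum_prod_type, Finset.mul_sum]
  simp only [hblock, ← Finset.mul_sum]
  linear_combination ((Fintype.card F : ℤ) - 1) * key

lemma sum_mul_residual [DecidableEq ρ] [DecidableEq (ℙ F (Fin m → F))] (hF : ringChar F ≠ 2)
    {R : Matrix ρ κ ℤ} (hκ : (Fintype.card κ : ℤ) = 2 * Fintype.card F)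
    (hR : ∀ r, ∑ c, R r c = (Fintype.card F : ℤ))
    (hRR : ∀ r r', 2 * ∑ c, R r c * R r' c =
      (if r = r' then (Fintype.card F : ℤ) + 1 else 0) + (Fintype.card F - 1))
    (P Q : ℙ F (Fin m → F)) (r r' : ρ) :
    2 * Fintype.card F * ∑ j : ℙ F (Fin m → F) × κ,
      signedBlock R (quadraticChar F (P.rep ⬝ᵥ j.1.rep)) r j.2 *
        signedBlock R (quadraticChar F (Q.rep ⬝ᵥ j.1.rep)) r' j.2 =
      Fintype.card F ^ m *
        ((if (P, r) = (Q, r') then (Fintype.card F : ℤ) + 1 else 0) + (Fintype.card F - 1)) := by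
  have hblock (a b : F) : 4 * ∑ c, signedBlock R (quadraticChar F a) r c *
      signedBlock R (quadraticChar F b) r' c =
      2 * Fintype.card F * (quadraticChar F a ^ 2 * quadraticChar F b ^ 2) +
        (4 * ∑ c, R r c * R r' c - 2 * Fintype.card F) *
          (quadraticChar F a * quadraticChar F b) := by
    set s := quadraticChar F a with hs
    set t := quadraticChar F b with ht
    calc
      _ = ∑ c, (s ^ 2 * t ^ 2 + s * t - s ^ 2 * t - s * t ^ 2 +
            (2 * s * t ^ 2 - 2 * s * t) * R r c + (2 * s ^ 2 * t - 2 * s * t) * R r' c +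
            4 * s * t * (R r c * R r' c)) := by
        rw [Finset.mul_sum]
        refine Finset.sum_congr rfl fun c _ => ?_
        have h₁ := two_mul_signedBlock_quadraticChar R a r c
        have h₂ := two_mul_signedBlock_quadraticChar R b r' c
        rw [← hs] at h₁
        rw [← ht] at h₂
        linear_combination 2 * signedBlock R t r' c * h₁ + (s ^ 2 + s * (2 * R r c - 1)) * h₂
      _ = _ := by
        simp only [Finset.sum_add_distrib, ← Finset.mul_sum, hR, Finset.sum_const,
          Finset.card_univ, nsmul_eq_mul, hκ]
        ring
  have hsum : 4 * ∑ j : ℙ F (Fin m → F) × κ,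
      signedBlock R (quadraticChar F (P.rep ⬝ᵥ j.1.rep)) r j.2 *
        signedBlock R (quadraticChar F (Q.rep ⬝ᵥ j.1.rep)) r' j.2 =
      2 * Fintype.card F * ∑ X : ℙ F (Fin m → F),
        quadraticChar F (P.rep ⬝ᵥ X.rep) ^ 2 * quadraticChar F (Q.rep ⬝ᵥ X.rep) ^ 2 +
      (4 * ∑ c, R r c * R r' c - 2 * Fintype.card F) * ∑ X : ℙ F (Fin m → F),
        quadraticChar F (P.rep ⬝ᵥ X.rep) * quadraticChar F (Q.rep ⬝ᵥ X.rep) := by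
    rw [Fintype.sum_prod_type, Finset.mul_sum]
    simp only [hblock, Finset.sum_add_distrib, ← Finset.mul_sum]
  by_cases hPQ : P = Q
  · subst hPQ
    have hfour (a : F) : quadraticChar F a ^ 2 * quadraticChar F a ^ 2 = quadraticChar F a ^ 2 := by
      by_cases ha : a = 0
      · simp [ha]
      · simp only [quadraticChar_sq_one ha, one_mul]
    have key := card_mul_sum_quadraticChar_sq P.rep_nonzero
    simp only [hfour, ← sq (quadraticChar F _)] at hsum
    simp only [Prod.mk.injEq, true_and, ← hRR]
    apply mul_left_cancel₀ (two_ne_zero (α := ℤ))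
    linear_combination (Fintype.card F : ℤ) * hsum + 4 * (∑ c, R r c * R r' c) * key
  · rw [sum_quadraticChar_mul_eq_zero hF hPQ] at hsum
    have key := card_sq_mul_sum_quadraticChar_sq_mul hPQ
    rw [if_neg (by simp [hPQ])]
    apply mul_left_cancel₀ (two_ne_zero (α := ℤ))
    linear_combination (Fintype.card F : ℤ) * hsum + 2 * key

/-- The rows of `designMatrix` have the inner products of a symmetric design. -/
lemma designMatrix_mul_transpose_apply [DecidableEq ρ] [DecidableEq (ℙ F (Fin m → F))]
    (hF : ringChar F ≠ 2) {D : Matrix F κ ℤ} {R : Matrix ρ κ ℤ}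
    (hκ : (Fintype.card κ : ℤ) = 2 * Fintype.card F)
    (hD : ∀ a, ∑ c, D a c = (Fintype.card F : ℤ) - 1)
    (hR : ∀ r, ∑ c, R r c = (Fintype.card F : ℤ))
    (hDD : ∀ a b, 2 * ∑ c, D a c * D b c =
      (if a = b then (Fintype.card F : ℤ) + 1 else 0) + (Fintype.card F - 3))
    (hDR : ∀ a r, 2 * ∑ c, D a c * R r c = (Fintype.card F : ℤ) - 1)
    (hRR : ∀ r r', 2 * ∑ c, R r c * R r' c =
      (if r = r' then (Fintype.card F : ℤ) + 1 else 0) + (Fintype.card F - 1)) (i j) :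
    2 * Fintype.card F * (designMatrix m D R * (designMatrix m D R)ᵀ) i j =
      Fintype.card F ^ m *
        ((if i = j then (Fintype.card F : ℤ) + 1 else 0) + (Fintype.card F - 1)) := by
  rcases i with x | ⟨P, r⟩ <;> rcases j with y | ⟨Q, r'⟩ <;>
    simp only [mul_apply, transpose_apply, Fintype.sum_sum_type, designMatrix, of_apply,
      fromBlocks_apply₁₁, fromBlocks_apply₁₂, fromBlocks_apply₂₁, fromBlocks_apply₂₂,
      Matrix.zero_apply, Finset.univ_unique, Finset.sum_singleton, mul_zero, mul_one, zero_add,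
      Sum.inl.injEq, Sum.inr.injEq, reduceCtorEq, if_false]
  · exact sum_mul_derived hDD x y
  · exact sum_derived_mul_residual hD hDR x Q r'
  · simp only [mul_comm (signedBlock _ _ _ _)]
    exact sum_derived_mul_residual hD hDR y P r
  · exact sum_mul_residual hF hκ hR hRR P Q r r'

end Construction

/-- A `(0,1)`-matrix has its row sums on the diagonal of its Gram matrix. -/
lemma mul_transpose_apply_self_eq_sum {ι κ : Type*} [Fintype κ] {A : Matrix ι κ ℤ}
    (hA : ∀ i j, A i j = 0 ∨ A i j = 1) (i : ι) : (A * Aᵀ) i i = ∑ j, A i j := by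
  simp only [mul_apply, transpose_apply]
  refine Finset.sum_congr rfl fun j _ => ?_
  rcases hA i j with h | h <;> simp [h]

/-- For an odd prime power `p`, if the derived design `D` and the residual design `R` of a
symmetric `2-(2p+1, p, (p-1)/2)` design are such that the residual design has a twin mate,
then there exists a symmetric `2-(2pM + 1, p^m, p^(m-1)(p-1)/2)` design, where
`(p-1) * M = p^m - 1`. -/
theorem stmt_6 (q t p m M : ℕ) (hq : q.Prime) (hodd : Odd q) (ht : 1 ≤ t) (hp : p = q ^ t)
    (hm : 1 ≤ m) (hM : (p - 1) * M = p ^ m - 1)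
    (D : Matrix (Fin p) (Fin (2 * p)) ℤ)
    (R : Matrix (Fin (p + 1)) (Fin (2 * p)) ℤ)
    (hD01 : ∀ i j, D i j = 0 ∨ D i j = 1)
    (hR01 : ∀ i j, R i j = 0 ∨ R i j = 1)
    (hNN : designN p D R * (designN p D R)ᵀ =
      (((p + 1) / 2 : ℕ) : ℤ) • 1 + (((p - 1) / 2 : ℕ) : ℤ) • Matrix.of fun _ _ => 1)
    (hTwin : ((Matrix.of fun _ _ => (1 : ℤ)) - R) * ((Matrix.of fun _ _ => (1 : ℤ)) - R)ᵀ =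
      (((p + 1) / 2 : ℕ) : ℤ) • 1 + (((p - 1) / 2 : ℕ) : ℤ) • Matrix.of fun _ _ => 1)
    (hTwinCol : ∀ j, (∑ i, ((1 : ℤ) - R i j)) = (((p + 1) / 2 : ℕ) : ℤ)) :
    ∃ N' : Matrix (Fin (2 * p * M + 1)) (Fin (2 * p * M + 1)) ℤ,
      (∀ i j, N' i j = 0 ∨ N' i j = 1) ∧
      N' * N'ᵀ = ((p ^ (m - 1) * (p + 1) / 2 : ℕ) : ℤ) • 1 +
        ((p ^ (m - 1) * (p - 1) / 2 : ℕ) : ℤ) • (Matrix.of fun _ _ => (1 : ℤ)) ∧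
      ∀ i, (∑ j, N' i j) = ((p ^ m : ℕ) : ℤ) := by
  classical
  obtain ⟨k, hk⟩ : Odd p := hp ▸ hodd.pow
  have hk1 : (p + 1) / 2 = k + 1 := by lia
  have hk2 : (p - 1) / 2 = k := by lia
  rw [hk1, hk2] at hNN
  have hpk : (p : ℤ) = 2 * k + 1 := by exact_mod_cast hk
  have hp1 : 1 < p := hp ▸ Nat.one_lt_pow (by lia) hq.one_lt
  have hN01 : ∀ i j, designN p D R i j = 0 ∨ designN p D R i j = 1 := by
    rintro (i | i) (_ | j) <;> simp [designN, hD01, hR01]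
  have hN (i j) : ∑ c, designN p D R i c * designN p D R j c =
      (k + 1) * (if i = j then 1 else 0) + (k : ℤ) := by
    have h := congrFun₂ hNN i j
    simpa only [mul_apply, transpose_apply, Matrix.add_apply, Matrix.smul_apply, one_apply,
      of_apply, smul_eq_mul, mul_one, Nat.cast_add, Nat.cast_one] using h
  have hsum (i) : ∑ c, designN p D R i c = (p : ℤ) := by
    rw [← mul_transpose_apply_self_eq_sum hN01, mul_apply]
    simp only [transpose_apply, hN, if_true]
    linear_combination -hpk
  have hD (i) : ∑ c, D i c = (p : ℤ) - 1 := by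
    have h := hsum (.inl i)
    simp [designN] at h
    linear_combination h
  have hR (i) : ∑ c, R i c = (p : ℤ) := by
    simpa [designN] using hsum (.inr i)
  have hDD (a b) : 2 * ∑ c, D a c * D b c =
      (if a = b then (p : ℤ) + 1 else 0) + (p - 3) := by
    have h := hN (.inl a) (.inl b)
    simp [designN] at h
    split_ifs at h ⊢
    · linear_combination 2 * h - 2 * hpk
    · linear_combination 2 * h - hpk
  have hDR (a r) : 2 * ∑ c, D a c * R r c = (p : ℤ) - 1 := by
    have h := hN (.inl a) (.inr r)
    simp [designN] at h
    linear_combination 2 * h - hpk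
  have hRR (r r') : 2 * ∑ c, R r c * R r' c =
      (if r = r' then (p : ℤ) + 1 else 0) + (p - 1) := by
    have h := hN (.inr r) (.inr r')
    simp [designN] at h
    split_ifs at h ⊢
    · linear_combination 2 * h - 2 * hpk
    · linear_combination 2 * h - hpk
  have : Fact q.Prime := ⟨hq⟩
  let F := GaloisField q t
  let : Fintype F := Fintype.ofFinite F
  let : Fintype (ℙ F (Fin m → F)) := Fintype.ofFinite _
  have hcard : Fintype.card F = p := by
    rw [← Nat.card_eq_fintype_card, GaloisField.card q t (by lia), hp]
  have hF : ringChar F ≠ 2 := by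
    rw [ringChar.eq F q]
    rintro rfl
    exact absurd hodd (by decide)
  have hpoints : Fintype.card (ℙ F (Fin m → F)) = M := by
    have h := Projectivization.card F (Fin m → F)
    simp only [Nat.card_eq_fintype_card, Fintype.card_fun, Fintype.card_fin, hcard] at h
    rw [← hM, mul_comm] at h
    exact (Nat.eq_of_mul_eq_mul_right (by lia) h).symm
  have hM' : p ^ m = (p - 1) * M + 1 := by
    have := Nat.one_le_pow m p (by lia)
    lia
  let e := Fintype.equivFinOfCardEq hcard
  let A := designMatrix m (D.submatrix e id) R
  have hA (i j) : 2 * (p : ℤ) * (A * Aᵀ) i j =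
      p ^ m * ((if i = j then (p : ℤ) + 1 else 0) + (p - 1)) := by
    simpa only [hcard] using designMatrix_mul_transpose_apply hF (D := D.submatrix e id)
      (by simp [hcard]) (by simp [hcard, hD]) (by simp [hcard, hR]) (by simp [hcard, hDD])
      (by simp [hcard, hDR]) (by simp [hcard, hRR]) i j
  let rows : Fin (2 * p * M + 1) ≃ (Fin m → F) ⊕ (ℙ F (Fin m → F) × Fin (p + 1)) :=
    (Fintype.equivFinOfCardEq (by
      simp only [Fintype.card_sum, Fintype.card_prod, Fintype.card_fun, Fintype.card_fin,
        hcard, hpoints, hM']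
      zify [hp1.le]
      ring)).symm
  let cols : Fin (2 * p * M + 1) ≃ Unit ⊕ (ℙ F (Fin m → F) × Fin (2 * p)) :=
    (Fintype.equivFinOfCardEq (by
      simp only [Fintype.card_sum, Fintype.card_prod, Fintype.card_fin, Fintype.card_unit,
        hpoints]
      ring)).symm
  have h01 (i j) : A.submatrix rows cols i j = 0 ∨ A.submatrix rows cols i j = 1 :=
    designMatrix_eq_zero_or_one m (D := D.submatrix e id) (fun a c => hD01 (e a) c) hR01 _ _
  have hdiv1 : p ^ (m - 1) * (p + 1) / 2 = p ^ (m - 1) * (k + 1) := by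
    rw [hk, show 2 * k + 1 + 1 = (k + 1) * 2 by ring, ← mul_assoc, Nat.mul_div_cancel _ two_pos]
  have hdiv2 : p ^ (m - 1) * (p - 1) / 2 = p ^ (m - 1) * k := by
    rw [Nat.mul_div_assoc _ (by lia : 2 ∣ p - 1), hk2]
  have hpow : (p : ℤ) ^ m = p ^ (m - 1) * p := (pow_sub_one_mul (by lia) _).symm
  have hGram : A.submatrix rows cols * (A.submatrix rows cols)ᵀ =
      ((p ^ (m - 1) * (p + 1) / 2 : ℕ) : ℤ) • 1 +
        ((p ^ (m - 1) * (p - 1) / 2 : ℕ) : ℤ) • (Matrix.of fun _ _ => (1 : ℤ)) := by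
    rw [transpose_submatrix, submatrix_mul_equiv, hdiv1, hdiv2]
    ext i j
    apply mul_left_cancel₀ (show 2 * (p : ℤ) ≠ 0 by lia)
    rw [submatrix_apply, hA, hpow]
    simp only [EmbeddingLike.apply_eq_iff_eq, Matrix.add_apply, Matrix.smul_apply, one_apply,
      of_apply, smul_eq_mul, hpk, Nat.cast_mul, Nat.cast_pow, Nat.cast_add, Nat.cast_one]
    split_ifs <;> ring
  refine ⟨A.submatrix rows cols, h01, hGram, fun i => ?_⟩
  rw [← mul_transpose_apply_self_eq_sum h01, hGram, hdiv1, hdiv2]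
  simp only [Matrix.add_apply, Matrix.smul_apply, one_apply_eq, of_apply, smul_eq_mul, Nat.cast_mul,
    Nat.cast_pow, Nat.cast_add, Nat.cast_one, hpow]
  linear_combination -(p : ℤ) ^ (m - 1) * hpk
end

section
/- There exists a weighing matrix W(89, 49), that is, an 89 × 89 integer matrix W with entries in {-1, 0, 1} satisfying W * Wᵀ = 49 • (identity matrix of order 89). -/
open Matrix

/-- If `c` is an orthogonal array of index one, the rows of `R` satisfy `R * Rᵀ = p • 1 - J`, the
rows of `D` are orthogonal to those of `R` and `D`, `V` have orthogonal rows of norm `p`, then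
the rows of `[1, R_c; 0, V ⊗ D]` are orthogonal of norm `p ^ 2`. -/
theorem fromBlocks_orthogonalArray_mul_transpose
    {Q M K N P : Type*} [Fintype M] [Fintype N] [DecidableEq Q] [DecidableEq M] [DecidableEq K]
    [DecidableEq P] (p : ℤ) (c : Q → M → P) (R : Matrix P N ℤ) (D : Matrix K N ℤ)
    (V : Matrix M M ℤ) (hM : (Fintype.card M : ℤ) = p + 1)
    (hc : ∀ q q', q ≠ q' → (Finset.univ.filter fun m => c q m = c q' m).card = 1)
    (hR : R * Rᵀ = p • 1 - of fun _ _ => 1) (hRD : R * Dᵀ = 0) (hD : D * Dᵀ = p • 1)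
    (hV : V * Vᵀ = p • 1) :
    let W : Matrix (Q ⊕ M × K) (Unit ⊕ M × N) ℤ :=
      fromBlocks (of fun _ _ => 1) (of fun q x => R (c q x.1) x.2) 0 (kronecker V D)
    W * Wᵀ = (p ^ 2) • 1 := by
  intro W
  have hR' : ∀ i j, ∑ n, R i n * R j n = (if i = j then p else 0) - 1 := fun i j => by
    simpa only [mul_apply, Matrix.sub_apply, Matrix.smul_apply, Matrix.one_apply, of_apply,
      transpose_apply, smul_eq_mul, mul_ite, mul_one, mul_zero] using congrFun (congrFun hR i) j
  have hRD' : ∀ i k, ∑ n, R i n * D k n = 0 := fun i k => by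
    simpa [mul_apply] using congrFun (congrFun hRD i) k
  have hD' : ∀ i j, ∑ n, D i n * D j n = if i = j then p else 0 := fun i j => by
    simpa [mul_apply, Matrix.one_apply] using congrFun (congrFun hD i) j
  have hV' : ∀ i j, ∑ n, V i n * V j n = if i = j then p else 0 := fun i j => by
    simpa [mul_apply, Matrix.one_apply] using congrFun (congrFun hV i) j
  have hQM : ∀ q m k, ∑ x : M × N, R (c q x.1) x.2 * (V m x.1 * D k x.2) = 0 := fun q m k => by
    rw [Fintype.sum_prod_type]
    refine Finset.sum_eq_zero fun x _ => ?_
    simp only [mul_left_comm _ (V m x), ← Finset.mul_sum, hRD', mul_zero]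
  ext (q | ⟨m, k⟩) (q' | ⟨m', k'⟩)
  · have h : (W * Wᵀ) (Sum.inl q) (Sum.inl q') =
        1 + ∑ m, ((if c q m = c q' m then p else 0) - 1) := by
      simp [W, mul_apply, Fintype.sum_prod_type, hR']
    rw [h, Finset.sum_sub_distrib, ← Finset.sum_filter]
    by_cases hq : q = q'
    · subst hq
      simp [hM]
      ring
    · simp [hc q q' hq, hM, hq]
  · simpa [W, mul_apply] using hQM q m' k'
  · simpa [W, mul_apply, mul_comm] using hQM q' m k
  · have h : (W * Wᵀ) (Sum.inr (m, k)) (Sum.inr (m', k')) =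
        (∑ x, V m x * V m' x) * ∑ n, D k n * D k' n := by
      simp [W, mul_apply, Fintype.sum_prod_type, Finset.sum_mul_sum, mul_mul_mul_comm]
    rw [h, hV', hD']
    by_cases hm : m = m' <;> by_cases hk : k = k' <;> simp [hm, hk, sq]

/-- The non-vertical lines of the affine plane over the integers modulo `7`, as an orthogonal array
of index one. -/
def affineArray (q : Fin 7 × Fin 7) : Option (Fin 7) → Fin 7
  | none => q.1
  | some m => q.1 * m + q.2

theorem card_affineArray_eq (q q' : Fin 7 × Fin 7) (h : q ≠ q') :
    (Finset.univ.filter fun m => affineArray q m = affineArray q' m).card = 1 := by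
  revert q q'
  decide +kernel

/-- The quadratic residue conference matrix of order `8`. -/
def conferenceEight : Matrix (Option (Fin 7)) (Option (Fin 7)) ℤ
  | none, none => 0
  | none, some _ => 1
  | some _, none => -1
  | some i, some j => if i = j then 0 else if IsSquare (i - j) then 1 else -1

/-- The rows of a weighing matrix `W(12, 7)` starting with `1`, with this first entry removed. -/
def weighingTwelveOne : Matrix (Fin 7) (Fin 11) ℤ :=
  !![1, 0, -1, 1, 1, 0, 0, 1, 0, 0, 1;
     0, 1, 1, -1, 1, 1, 0, 0, 1, 0, 0;
     -1, -1, 1, 1, 0, 0, 0, 1, 0, 0, -1;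
     1, -1, 0, -1, -1, 0, -1, 0, 0, 1, 0;
     -1, 1, -1, 0, -1, -1, 0, 0, 1, 0, 0;
     0, 0, 1, 0, 0, -1, 0, -1, -1, -1, 1;
     0, 0, -1, 0, 0, 1, 1, -1, -1, 0, -1]

/-- The rows of a weighing matrix `W(12, 7)` starting with `0`, with this first entry removed. -/
def weighingTwelveZero : Matrix (Fin 5) (Fin 11) ℤ :=
  !![1, 1, 1, 1, -1, 0, 1, 0, 0, 1, 0;
     0, -1, 0, 0, -1, 1, 1, 0, 1, -1, 1;
     -1, 0, 0, -1, 0, 0, 1, 1, -1, 1, 1;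
     0, -1, 0, 0, 1, -1, 1, -1, 1, 1, 0;
     -1, 0, 0, 1, 0, 1, -1, -1, 0, 1, 1]

/-- There exists a weighing matrix `W(89, 49)`. -/
theorem stmt_19 :
    ∃ W : Matrix (Fin 89) (Fin 89) ℤ,
      (∀ i j, W i j = -1 ∨ W i j = 0 ∨ W i j = 1) ∧
      W * Wᵀ = (49 : ℤ) • 1 := by
  let W : Matrix ((Fin 7 × Fin 7) ⊕ (Option (Fin 7) × Fin 5))
      (Unit ⊕ (Option (Fin 7) × Fin 11)) ℤ :=
    fromBlocks (of fun _ _ => 1) (of fun q x => weighingTwelveOne (affineArray q x.1) x.2) 0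
      (kronecker conferenceEight weighingTwelveZero)
  have hW : W * Wᵀ = ((7 : ℤ) ^ 2) • 1 :=
    fromBlocks_orthogonalArray_mul_transpose 7 affineArray weighingTwelveOne weighingTwelveZero
      conferenceEight (by simp) card_affineArray_eq (by decide +kernel)
      (by decide +kernel) (by decide +kernel) (by decide +kernel)
  have hR : ∀ x : Fin 7 × Fin 11, weighingTwelveOne x.1 x.2 = -1 ∨
      weighingTwelveOne x.1 x.2 = 0 ∨ weighingTwelveOne x.1 x.2 = 1 := by decide +kernel
  have hVD : ∀ i j k l,
      conferenceEight i j * weighingTwelveZero k l = -1 ∨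
      conferenceEight i j * weighingTwelveZero k l = 0 ∨
      conferenceEight i j * weighingTwelveZero k l = 1 := by decide +kernel
  let e : Fin 89 ≃ (Fin 7 × Fin 7) ⊕ (Option (Fin 7) × Fin 5) :=
    (Fintype.equivFinOfCardEq (by simp)).symm
  let f : Fin 89 ≃ Unit ⊕ (Option (Fin 7) × Fin 11) :=
    (Fintype.equivFinOfCardEq (by simp)).symm
  refine ⟨W.submatrix e f, fun i j => ?_, ?_⟩
  · rw [submatrix_apply]
    rcases e i with q | ⟨m, k⟩ <;> rcases f j with u | ⟨m', n⟩
    · exact Or.inr (Or.inr rfl)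
    · exact hR (_, _)
    · exact Or.inr (Or.inl rfl)
    · exact hVD m m' k n
  · rw [transpose_submatrix, submatrix_mul_equiv, hW, submatrix_smul]
    simp
end
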